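/- Let H be a separable complex Hilbert space, let K(H) denote the compact operators, and let B₁ and B₂ be closed star-subalgebras of B(H) each containing K(H). Suppose Φ : B₁ → B₂ is a star-algebra isomorphism satisfying Φ(K(H)) = K(H). Then Φ is unitarily implemented: there exists a unitary operator U ∈ B(H) such that Φ(y) = U y U* for all y ∈ B₁. -/

import Mathlib

open InnerProductSpace ContinuousLinearMap in
/-- A star-algebra isomorphism between star-subalgebras of `B(H)` and `B(K)` which contain the
rank-one operators is spatial. -/
theorem StarAlgEquiv.exists_linearIsometryEquiv_of_rankOne_mem
    {𝕜 H K : Type*} [RCLike 𝕜] [NormedAddCommGroup H] [InnerProductSpace 𝕜 H] [CompleteSpace H]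
    [Nontrivial H] [NormedAddCommGroup K] [InnerProductSpace 𝕜 K] [CompleteSpace K]
    {A : StarSubalgebra 𝕜 (H →L[𝕜] H)} {B : StarSubalgebra 𝕜 (K →L[𝕜] K)}
    (hA : ∀ x y : H, rankOne 𝕜 x y ∈ A) (hB : ∀ x y : K, rankOne 𝕜 x y ∈ B) (Φ : A ≃⋆ₐ[𝕜] B) :
    ∃ V : H ≃ₗᵢ[𝕜] K, ∀ (a : A) (x : H), V ((a : H →L[𝕜] H) x) = (Φ a : K →L[𝕜] K) (V x) := by
  obtain ⟨e₀, he₀⟩ := exists_ne (0 : H)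
  obtain ⟨e, he⟩ : ∃ e : H, inner 𝕜 e e = (1 : 𝕜) :=
    ⟨((‖e₀‖⁻¹ : ℝ) : 𝕜) • e₀, by
      rw [inner_self_eq_norm_sq_to_K, norm_smul]
      simp [he₀]⟩
  let W : H →ₗ[𝕜] A :=
    { toFun x := ⟨rankOne 𝕜 x e, hA x e⟩
      map_add' x y := by ext; simp
      map_smul' c x := by ext; simp }
  have W_coe (x : H) : (W x : H →L[𝕜] H) = rankOne 𝕜 x e := rfl
  have mul_W (a : A) (x : H) : a * W x = W ((a : H →L[𝕜] H) x) :=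
    Subtype.ext (comp_rankOne x e (a : H →L[𝕜] H))
  have star_W_mul_W (x y : H) : star (W x) * W y = inner 𝕜 x y • W e := by
    ext z
    simp [W_coe, star_eq_adjoint, smul_smul, mul_comm]
  have W_e_ne : Φ (W e) ≠ 0 := by
    rw [Ne, EmbeddingLike.map_eq_zero_iff]
    intro h
    have h' : rankOne 𝕜 e e e = 0 := by rw [← W_coe, h]; rfl
    rw [rankOne_apply, he, one_smul] at h'
    simp [h'] at he
  obtain ⟨f, hf, hWf⟩ : ∃ f : K, inner 𝕜 f f = (1 : 𝕜) ∧ (Φ (W e) : K →L[𝕜] K) f = f := by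
    obtain ⟨g, hg⟩ : ∃ g, (Φ (W e) : K →L[𝕜] K) g ≠ 0 := by
      by_contra! h
      exact W_e_ne (Subtype.ext (ContinuousLinearMap.ext h))
    have idem : Φ (W e) * Φ (W e) = Φ (W e) := by
      rw [← map_mul, mul_W, W_coe, rankOne_apply, he, one_smul]
    refine ⟨((‖(Φ (W e) : K →L[𝕜] K) g‖⁻¹ : ℝ) : 𝕜) • (Φ (W e) : K →L[𝕜] K) g, ?_, ?_⟩
    · rw [inner_self_eq_norm_sq_to_K, norm_smul]
      simp [hg]
    · rw [map_smul]
      congr 1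
      exact DFunLike.congr_fun (congrArg Subtype.val idem) g
  let V₀ : H →ₗ[𝕜] K :=
    { toFun x := (Φ (W x) : K →L[𝕜] K) f
      map_add' x y := by simp
      map_smul' c x := by simp }
  have V₀_apply (x : H) : V₀ x = (Φ (W x) : K →L[𝕜] K) f := rfl
  have V₀_map (a : A) (x : H) : V₀ ((a : H →L[𝕜] H) x) = (Φ a : K →L[𝕜] K) (V₀ x) := by
    rw [V₀_apply, ← mul_W, map_mul]
    rfl
  have V₀_inner (x y : H) : inner 𝕜 (V₀ x) (V₀ y) = inner 𝕜 x y := by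
    have key : star (Φ (W x)) * Φ (W y) = inner 𝕜 x y • Φ (W e) := by
      rw [← map_star, ← map_mul, star_W_mul_W, map_smul]
    have key' : adjoint (Φ (W x) : K →L[𝕜] K) ((Φ (W y) : K →L[𝕜] K) f) = inner 𝕜 x y • f := by
      conv_rhs => rw [← hWf]
      exact DFunLike.congr_fun (congrArg Subtype.val key) f
    rw [V₀_apply, V₀_apply, ← adjoint_inner_right, key', inner_smul_right, hf, mul_one]
  have V₀_surj : Function.Surjective V₀ := fun y => by
    let b : B := ⟨rankOne 𝕜 y f, hB y f⟩
    refine ⟨(Φ.symm b : H →L[𝕜] H) e, ?_⟩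
    rw [V₀_map, V₀_apply, hWf, StarAlgEquiv.apply_symm_apply]
    change rankOne 𝕜 y f f = y
    rw [rankOne_apply, hf, one_smul]
  exact ⟨.ofSurjective (V₀.isometryOfInner V₀_inner) V₀_surj, V₀_map⟩

/-- Rank-one operators are compact. -/
theorem InnerProductSpace.isCompactOperator_rankOne {𝕜 E F : Type*} [RCLike 𝕜]
    [NormedAddCommGroup E] [NormedSpace 𝕜 E] [NormedAddCommGroup F] [InnerProductSpace 𝕜 F]
    (x : E) (y : F) : IsCompactOperator (InnerProductSpace.rankOne 𝕜 x y) := by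
  have h : IsCompactOperator (innerSL 𝕜 y) :=
    isCompactOperator_of_locallyCompactSpace_dom (innerSL 𝕜 y)
  exact h.clm_comp (ContinuousLinearMap.toSpanSingleton 𝕜 x)

/-- A star-algebra isomorphism between closed star-subalgebras of `B(H)` (for `H` a
separable complex Hilbert space), each containing the compact operators, which maps the
compact operators onto the compact operators, is unitarily implemented. -/
theorem stmt1
    {H : Type*} [NormedAddCommGroup H] [InnerProductSpace ℂ H] [CompleteSpace H]
    [TopologicalSpace.SeparableSpace H]
    (B₁ B₂ : StarSubalgebra ℂ (H →L[ℂ] H))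
    (hB₁ : IsClosed (B₁ : Set (H →L[ℂ] H))) (hB₂ : IsClosed (B₂ : Set (H →L[ℂ] H)))
    (hKB₁ : ∀ k : H →L[ℂ] H, IsCompactOperator k → k ∈ B₁)
    (hKB₂ : ∀ k : H →L[ℂ] H, IsCompactOperator k → k ∈ B₂)
    (Φ : B₁ ≃⋆ₐ[ℂ] B₂)
    (hΦK : ∀ x : B₁, IsCompactOperator ((x : H →L[ℂ] H)) ↔
      IsCompactOperator ((Φ x : H →L[ℂ] H))) :
    ∃ U ∈ unitary (H →L[ℂ] H),
      ∀ y : B₁, (Φ y : H →L[ℂ] H) = U * (y : H →L[ℂ] H) * star U := by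
  rcases subsingleton_or_nontrivial H with _ | _
  · exact ⟨1, one_mem _, fun y => Subsingleton.elim _ _⟩
  obtain ⟨V, hV⟩ := Φ.exists_linearIsometryEquiv_of_rankOne_mem
    (fun x y => hKB₁ _ (InnerProductSpace.isCompactOperator_rankOne x y))
    (fun x y => hKB₂ _ (InnerProductSpace.isCompactOperator_rankOne x y))
  refine ⟨V, (Unitary.linearIsometryEquiv.symm V).2, fun y => ?_⟩
  ext x
  rw [V.star_eq_symm]
  simpa using (hV y (V.symm x)).symm
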